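/- arXiv:1602.04017 — 2 statements merged into one kernel-verified Lean document; each statement's English description precedes it below -/
import Mathlib

section
/- Let α ≥ 1 and let (a_n)_{n∈ℕ₀^d} be complex numbers such that there exist c > 0 and a > 1 with |a_n| ≤ c a^{−|n|^{1/α}} for all n ∈ ℕ₀^d. Let F(w) = ∏_{j=1}^d (1−w_j) · ∑_{n∈ℕ₀^d} a_n w^n for w in the open unit polydisc D. Then there exist constants C, A > 0 such that |D^p F(w)| ≤ C A^{|p|} p^{αp} for all p ∈ ℕ₀^d and all w ∈ D. -/
open Filter Finset

noncomputable section

/-- The open unit polydisc. -/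
def Dpoly (d : ℕ) : Set (Fin d → ℂ) := {w | ∀ l, ‖w l‖ < 1}

/-- Complex partial derivative in the `i`-th coordinate direction. -/
def pdC {d : ℕ} (i : Fin d) (F : (Fin d → ℂ) → ℂ) : (Fin d → ℂ) → ℂ :=
  fun w => fderiv ℂ F w (Pi.single i 1)

/-- Multi-index complex derivative `D^p F`. -/
def mderivC {d : ℕ} (p : Fin d → ℕ) (F : (Fin d → ℂ) → ℂ) : (Fin d → ℂ) → ℂ :=
  ((List.ofFn fun i : Fin d => (fun G => (pdC i)^[p i] G)).foldr (· ∘ ·) id) F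

/-- `F(w) = ∏(1−w_j) ∑_n a_n w^n`. -/
def Fser {d : ℕ} (a : (Fin d → ℕ) → ℂ) : (Fin d → ℂ) → ℂ :=
  fun w => (∏ j, (1 - w j)) * ∑' n : Fin d → ℕ, a n * ∏ l, w l ^ n l

/-- A nonnegative sequence all of whose moments are summable. -/
def RapidDecay (u : ℕ → ℝ) : Prop :=
  (∀ m, 0 ≤ u m) ∧ ∀ k : ℕ, Summable fun m : ℕ => (m : ℝ) ^ k * u m

/-- The action of differentiation on the coefficients of a one-variable power series. -/
def coeffDeriv (u : ℕ → ℝ) : ℕ → ℝ := fun m => ((m : ℝ) + 1) * u (m + 1)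

/-- On the polydisc, `f` is the sum of a power series whose coefficients are dominated by
`C * ∏ l, u l (n l)`. -/
def HasDominatedSeries {d : ℕ} (C : ℝ) (u : Fin d → ℕ → ℝ) (f : (Fin d → ℂ) → ℂ) : Prop :=
  ∃ e : (Fin d → ℕ) → ℂ, (∀ n, ‖e n‖ ≤ C * ∏ l, u l (n l)) ∧
    ∀ w ∈ Dpoly d, f w = ∑' n : Fin d → ℕ, e n * ∏ l, w l ^ n l

theorem Dpoly_eq_ball (d : ℕ) : Dpoly d = Metric.ball 0 1 := by
  ext w
  simp [Dpoly, pi_norm_lt_iff]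

theorem RapidDecay.summable {u : ℕ → ℝ} (hu : RapidDecay u) : Summable u := by
  simpa using hu.2 0

theorem RapidDecay.one_add_mul {u : ℕ → ℝ} (hu : RapidDecay u) :
    RapidDecay fun m => (1 + (m : ℝ)) * u m := by
  refine ⟨fun m => mul_nonneg (by positivity) (hu.1 m), fun k => ?_⟩
  refine ((hu.2 k).add (hu.2 (k + 1))).congr fun m => ?_
  ring

theorem RapidDecay.coeffDeriv {u : ℕ → ℝ} (hu : RapidDecay u) : RapidDecay (coeffDeriv u) := by
  refine ⟨fun m => mul_nonneg (by positivity) (hu.1 _), fun k => ?_⟩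
  have h := (summable_nat_add_iff 1).2 (hu.2 (k + 1))
  refine Summable.of_nonneg_of_le
    (fun m => mul_nonneg (by positivity) (mul_nonneg (by positivity) (hu.1 _))) (fun m => ?_) h
  have h1 : (m : ℝ) ^ k ≤ ((m : ℝ) + 1) ^ k := by gcongr; linarith
  calc (m : ℝ) ^ k * (((m : ℝ) + 1) * u (m + 1))
      ≤ ((m : ℝ) + 1) ^ k * (((m : ℝ) + 1) * u (m + 1)) :=
        mul_le_mul_of_nonneg_right h1 (mul_nonneg (by positivity) (hu.1 _))
    _ = ((m + 1 : ℕ) : ℝ) ^ (k + 1) * u (m + 1) := by push_cast; ring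

theorem RapidDecay.iterate_coeffDeriv {u : ℕ → ℝ} (hu : RapidDecay u) (k : ℕ) :
    RapidDecay (_root_.coeffDeriv^[k] u) := by
  induction k with
  | zero => exact hu
  | succ k ih => rw [Function.iterate_succ']; exact ih.coeffDeriv

theorem sum_prod_le_prod_tsum {d : ℕ} {u : Fin d → ℕ → ℝ} (h0 : ∀ l m, 0 ≤ u l m)
    (hs : ∀ l, Summable (u l)) (s : Finset (Fin d → ℕ)) :
    ∑ n ∈ s, ∏ l, u l (n l) ≤ ∏ l, ∑' m, u l m := by
  classical
  have hsub : s ⊆ Fintype.piFinset fun l => s.image fun n => n l := fun n hn =>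
    Fintype.mem_piFinset.2 fun l => Finset.mem_image_of_mem _ hn
  calc ∑ n ∈ s, ∏ l, u l (n l)
      ≤ ∑ n ∈ Fintype.piFinset fun l => s.image fun n => n l, ∏ l, u l (n l) :=
        Finset.sum_le_sum_of_subset_of_nonneg hsub fun n _ _ =>
          Finset.prod_nonneg fun l _ => h0 l _
    _ = ∏ l, ∑ m ∈ s.image fun n => n l, u l m := (Finset.prod_univ_sum _ _).symm
    _ ≤ ∏ l, ∑' m, u l m := Finset.prod_le_prod
        (fun l _ => Finset.sum_nonneg fun m _ => h0 l m)
        fun l _ => (hs l).sum_le_tsum _ fun m _ => h0 l m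

theorem summable_pi_prod {d : ℕ} {u : Fin d → ℕ → ℝ} (h0 : ∀ l m, 0 ≤ u l m)
    (hs : ∀ l, Summable (u l)) : Summable fun n : Fin d → ℕ => ∏ l, u l (n l) :=
  summable_of_sum_le (fun _ => Finset.prod_nonneg fun l _ => h0 l _) (sum_prod_le_prod_tsum h0 hs)

theorem tsum_pi_prod_le {d : ℕ} {u : Fin d → ℕ → ℝ} (h0 : ∀ l m, 0 ≤ u l m)
    (hs : ∀ l, Summable (u l)) : ∑' n : Fin d → ℕ, ∏ l, u l (n l) ≤ ∏ l, ∑' m, u l m :=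
  Real.tsum_le_of_sum_le (fun _ => Finset.prod_nonneg fun l _ => h0 l _)
    (sum_prod_le_prod_tsum h0 hs)

theorem norm_prod_pow_le_one {d : ℕ} {w : Fin d → ℂ} (hw : w ∈ Dpoly d) (s : Finset (Fin d))
    (n : Fin d → ℕ) : ‖∏ l ∈ s, w l ^ n l‖ ≤ 1 := by
  rw [norm_prod]
  refine Finset.prod_le_one (fun _ _ => norm_nonneg _) fun l _ => ?_
  rw [norm_pow]
  exact pow_le_one₀ (norm_nonneg _) (hw l).le

theorem norm_mul_prod_pow_le {d : ℕ} {w : Fin d → ℂ} (hw : w ∈ Dpoly d) (z : ℂ)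
    (n : Fin d → ℕ) : ‖z * ∏ l, w l ^ n l‖ ≤ ‖z‖ := by
  rw [norm_mul]
  exact mul_le_of_le_one_right (norm_nonneg _) (norm_prod_pow_le_one hw _ n)

theorem HasDominatedSeries.norm_le {d : ℕ} {C : ℝ} {u : Fin d → ℕ → ℝ} {f : (Fin d → ℂ) → ℂ}
    (hf : HasDominatedSeries C u f) (hC : 0 ≤ C) (hu : ∀ l, RapidDecay (u l)) {w : Fin d → ℂ}
    (hw : w ∈ Dpoly d) : ‖f w‖ ≤ C * ∏ l, ∑' m, u l m := by
  obtain ⟨e, he, hfe⟩ := hf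
  have h0 := fun l => (hu l).1
  have hs := fun l => (hu l).summable
  rw [hfe w hw]
  calc _ ≤ C * ∑' n : Fin d → ℕ, ∏ l, u l (n l) :=
        tsum_of_norm_bounded ((summable_pi_prod h0 hs).hasSum.mul_left C)
          fun n => (norm_mul_prod_pow_le hw _ n).trans (he n)
    _ ≤ _ := mul_le_mul_of_nonneg_left (tsum_pi_prod_le h0 hs) hC

theorem tsum_add_single {d : ℕ} (i : Fin d) {g : (Fin d → ℕ) → ℂ} (hg : ∀ n, n i = 0 → g n = 0) :
    ∑' n, g (n + (Pi.single i 1 : Fin d → ℕ)) = ∑' n, g n := by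
  refine (add_left_injective (Pi.single i 1 : Fin d → ℕ)).tsum_eq fun n hn => ?_
  have h : n i ≠ 0 := fun h => hn (hg n h)
  refine ⟨n - Pi.single i 1, ?_⟩
  funext l
  rcases eq_or_ne l i with rfl | hl
  · simp only [Pi.add_apply, Pi.sub_apply, Pi.single_eq_same]
    omega
  · simp [hl]

theorem prod_erase_add_single {d : ℕ} {M : Type*} [CommMonoid M] (v : Fin d → ℕ → M)
    (i : Fin d) (n : Fin d → ℕ) :
    ∏ l ∈ univ.erase i, v l ((n + (Pi.single i 1 : Fin d → ℕ)) l) = ∏ l ∈ univ.erase i, v l (n l) := by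
  refine Finset.prod_congr rfl fun l hl => ?_
  simp [(Finset.mem_erase.1 hl).1]

theorem prod_add_single {d : ℕ} {M : Type*} [CommMonoid M] (v : Fin d → ℕ → M)
    (i : Fin d) (n : Fin d → ℕ) :
    ∏ l, v l ((n + (Pi.single i 1 : Fin d → ℕ)) l) = v i (n i + 1) * ∏ l ∈ univ.erase i, v l (n l) := by
  rw [← Finset.mul_prod_erase _ _ (Finset.mem_univ i), prod_erase_add_single]
  simp

theorem prod_update_eq_mul_prod_erase {d : ℕ} (u : Fin d → ℕ → ℝ) (i : Fin d) (v : ℕ → ℝ)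
    (n : Fin d → ℕ) :
    ∏ l, Function.update u i v l (n l) = v (n i) * ∏ l ∈ univ.erase i, u l (n l) := by
  rw [← Finset.mul_prod_erase _ _ (Finset.mem_univ i), Function.update_self]
  congr 1
  refine Finset.prod_congr rfl fun l hl => ?_
  rw [Function.update_of_ne (Finset.mem_erase.1 hl).1]

theorem HasDominatedSeries.one_sub_mul {d : ℕ} {C K : ℝ} {u : Fin d → ℕ → ℝ}
    {f : (Fin d → ℂ) → ℂ} (hf : HasDominatedSeries C u f) (hC : 0 ≤ C)
    (hu : ∀ l, RapidDecay (u l)) (hK : 0 ≤ K) (hKu : ∀ l m, u l m ≤ K * u l (m + 1))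
    (j : Fin d) : HasDominatedSeries (C * (1 + K)) u fun w => (1 - w j) * f w := by
  obtain ⟨e, he, hfe⟩ := hf
  have h0 := fun l => (hu l).1
  have hsum := (summable_pi_prod h0 fun l => (hu l).summable).mul_left C
  have hP : ∀ n : Fin d → ℕ, 0 ≤ ∏ l, u l (n l) := fun n => Finset.prod_nonneg fun l _ => h0 l _
  let e' : (Fin d → ℕ) → ℂ := fun n => if n j = 0 then 0 else e (n - Pi.single j 1)
  have he' : ∀ n, ‖e' n‖ ≤ C * K * ∏ l, u l (n l) := by
    intro n
    by_cases hn : n j = 0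
    · simpa [e', hn] using mul_nonneg (mul_nonneg hC hK) (hP n)
    · obtain ⟨n, rfl⟩ : ∃ m, n = m + (Pi.single j 1 : Fin d → ℕ) := by
        refine ⟨n - Pi.single j 1, ?_⟩
        funext l
        rcases eq_or_ne l j with rfl | hl
        · simp only [Pi.add_apply, Pi.sub_apply, Pi.single_eq_same]
          omega
        · simp [hl]
      simp only [e', hn, if_false, add_tsub_cancel_right]
      refine (he n).trans ?_
      rw [prod_add_single, ← Finset.mul_prod_erase _ _ (Finset.mem_univ j), mul_assoc]
      refine mul_le_mul_of_nonneg_left ?_ hC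
      rw [← mul_assoc]
      exact mul_le_mul_of_nonneg_right (hKu _ _) (Finset.prod_nonneg fun l _ => h0 l _)
  refine ⟨fun n => e n - e' n, fun n => ?_, fun w hw => ?_⟩
  · calc ‖e n - e' n‖ ≤ ‖e n‖ + ‖e' n‖ := norm_sub_le _ _
      _ ≤ C * ∏ l, u l (n l) + C * K * ∏ l, u l (n l) := add_le_add (he n) (he' n)
      _ = _ := by ring
  · have hs : Summable fun n : Fin d → ℕ => e n * ∏ l, w l ^ n l :=
      Summable.of_norm_bounded hsum fun n => (norm_mul_prod_pow_le hw _ n).trans (he n)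
    have hs' : Summable fun n : Fin d → ℕ => e' n * ∏ l, w l ^ n l :=
      Summable.of_norm_bounded ((summable_pi_prod h0 fun l => (hu l).summable).mul_left (C * K))
        fun n => (norm_mul_prod_pow_le hw _ n).trans (he' n)
    have hshift : w j * ∑' n : Fin d → ℕ, e n * ∏ l, w l ^ n l =
        ∑' n : Fin d → ℕ, e' n * ∏ l, w l ^ n l := by
      rw [← tsum_add_single (g := fun n => e' n * ∏ l, w l ^ n l) j
        (fun n hn => by simp [e', hn]), ← tsum_mul_left]
      refine tsum_congr fun n => ?_
      rw [prod_add_single (fun l m => w l ^ m), ← Finset.mul_prod_erase _ _ (Finset.mem_univ j)]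
      simp only [e', Pi.add_apply, Pi.single_eq_same, Nat.add_eq_zero_iff, one_ne_zero, and_false,
        if_false, add_tsub_cancel_right]
      ring
    simp only [sub_mul]
    rw [hs.tsum_sub hs', ← hshift, hfe w hw]
    ring

theorem HasDominatedSeries.prod_one_sub_mul {d : ℕ} {C K : ℝ} {u : Fin d → ℕ → ℝ}
    {f : (Fin d → ℂ) → ℂ} (hf : HasDominatedSeries C u f) (hC : 0 ≤ C)
    (hu : ∀ l, RapidDecay (u l)) (hK : 0 ≤ K) (hKu : ∀ l m, u l m ≤ K * u l (m + 1))
    (s : Finset (Fin d)) :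
    HasDominatedSeries (C * (1 + K) ^ s.card) u fun w => (∏ j ∈ s, (1 - w j)) * f w := by
  classical
  induction s using Finset.induction_on with
  | empty => simpa using hf
  | insert j s hj ih =>
    have h := ih.one_sub_mul (by positivity) hu hK hKu j
    simpa only [Finset.card_insert_of_notMem hj, pow_succ, Finset.prod_insert hj, mul_assoc]
      using h

theorem sum_natCast_le_prod_one_add {ι : Type*} (s : Finset ι) (n : ι → ℕ) :
    ∑ l ∈ s, (n l : ℝ) ≤ ∏ l ∈ s, (1 + (n l : ℝ)) := by
  classical
  have h : 1 + ∑ l ∈ s, (n l : ℝ) ≤ ∏ l ∈ s, (1 + (n l : ℝ)) := by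
    induction s using Finset.induction_on with
    | empty => simp
    | insert j s hj ih =>
      rw [Finset.sum_insert hj, Finset.prod_insert hj]
      have : (0 : ℝ) ≤ ∑ l ∈ s, (n l : ℝ) := by positivity
      have hj0 : (0 : ℝ) ≤ n j := by positivity
      nlinarith
  linarith

theorem norm_proj_le_one {d : ℕ} (l : Fin d) :
    ‖(ContinuousLinearMap.proj l : (Fin d → ℂ) →L[ℂ] ℂ)‖ ≤ 1 :=
  ContinuousLinearMap.opNorm_le_bound _ zero_le_one fun w => by simpa using norm_le_pi_norm w l

/-- Termwise differentiation of a dominated power series. -/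
theorem HasDominatedSeries.pdC {d : ℕ} {C : ℝ} {u : Fin d → ℕ → ℝ} {f : (Fin d → ℂ) → ℂ}
    (hf : HasDominatedSeries C u f) (hu : ∀ l, RapidDecay (u l)) (i : Fin d) :
    HasDominatedSeries C (Function.update u i (coeffDeriv (u i))) (pdC i f) := by
  obtain ⟨e, he, hfe⟩ := hf
  have hopen : IsOpen (Dpoly d) := Dpoly_eq_ball d ▸ Metric.isOpen_ball
  have hconn : IsPreconnected (Dpoly d) := by
    rw [Dpoly_eq_ball]
    exact (convex_ball _ _).isPreconnected
  have h0 := fun l => (hu l).1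
  have hbig : Summable fun n : Fin d → ℕ => C * ∏ l, ((1 + (n l : ℝ)) * u l (n l)) :=
    (summable_pi_prod (fun l => (hu l).one_add_mul.1)
      fun l => (hu l).one_add_mul.summable).mul_left C
  let f' : (Fin d → ℕ) → (Fin d → ℂ) → (Fin d → ℂ) →L[ℂ] ℂ := fun n w =>
    e n • ∑ l, (∏ k ∈ univ.erase l, w k ^ n k) •
      ((n l • w l ^ (n l - 1)) • ContinuousLinearMap.proj l)
  have hder : ∀ n, ∀ w ∈ Dpoly d,
      HasFDerivAt (fun w : Fin d → ℂ => e n * ∏ l, w l ^ n l) (f' n w) w := fun n w _ =>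
    (HasFDerivAt.finsetProd fun l _ => (hasFDerivAt_apply l w).pow (n l)).const_mul (e n)
  have hbound : ∀ n, ∀ w ∈ Dpoly d, ‖f' n w‖ ≤ C * ∏ l, ((1 + (n l : ℝ)) * u l (n l)) := by
    intro n w hw
    have hsum : ‖∑ l, (∏ k ∈ univ.erase l, w k ^ n k) • ((n l • w l ^ (n l - 1)) •
        (ContinuousLinearMap.proj l : (Fin d → ℂ) →L[ℂ] ℂ))‖ ≤ ∑ l, (n l : ℝ) := by
      refine norm_sum_le_of_le _ fun l _ => ?_
      have h1 := norm_prod_pow_le_one hw (univ.erase l) n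
      have h2 : ‖w l ^ (n l - 1)‖ ≤ 1 := by
        rw [norm_pow]
        exact pow_le_one₀ (norm_nonneg _) (hw l).le
      rw [norm_smul, norm_smul, nsmul_eq_mul, norm_mul, Complex.norm_natCast]
      calc _ ≤ 1 * ((n l : ℝ) * 1 * 1) := by gcongr; exact norm_proj_le_one l
        _ = n l := by ring
    calc ‖f' n w‖ ≤ (C * ∏ l, u l (n l)) * ∏ l, (1 + (n l : ℝ)) := by
          rw [norm_smul]
          exact mul_le_mul (he n) (hsum.trans (sum_natCast_le_prod_one_add _ _)) (norm_nonneg _)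
            ((norm_nonneg _).trans (he n))
      _ = _ := by rw [Finset.prod_mul_distrib]; ring
  have hsum0 : ∀ w ∈ Dpoly d, Summable fun n : Fin d → ℕ => e n * ∏ l, w l ^ n l := fun w hw =>
    Summable.of_norm_bounded ((summable_pi_prod h0 fun l => (hu l).summable).mul_left C)
      fun n => (norm_mul_prod_pow_le hw _ n).trans (he n)
  refine ⟨fun n => ((n i : ℂ) + 1) * e (n + (Pi.single i 1 : Fin d → ℕ)), fun n => ?_, fun w hw => ?_⟩
  · have hcast : ‖(n i : ℂ) + 1‖ = (n i : ℝ) + 1 := by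
      rw [← Nat.cast_add_one, Complex.norm_natCast]
      push_cast
      rfl
    rw [prod_update_eq_mul_prod_erase, norm_mul, hcast]
    calc ((n i : ℝ) + 1) * ‖e (n + (Pi.single i 1 : Fin d → ℕ))‖
        ≤ ((n i : ℝ) + 1) * (C * ∏ l, u l ((n + (Pi.single i 1 : Fin d → ℕ)) l)) := by gcongr; exact he _
      _ = _ := by rw [prod_add_single, coeffDeriv]; ring
  · have hF := hasFDerivAt_tsum_of_isPreconnected hbig hopen hconn hder hbound hw (hsum0 w hw) hw
    have heq : f =ᶠ[nhds w] fun w => ∑' n : Fin d → ℕ, e n * ∏ l, w l ^ n l :=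
      Filter.eventually_of_mem (hopen.mem_nhds hw) hfe
    have hsf : Summable fun n => f' n w := Summable.of_norm_bounded hbig fun n => hbound n w hw
    have happ : ∀ n, f' n w (Pi.single i 1) =
        e n * ((∏ k ∈ univ.erase i, w k ^ n k) * (n i * w i ^ (n i - 1))) := by
      intro n
      simp only [f', smul_apply, _root_.sum_apply,
        ContinuousLinearMap.proj_apply, smul_eq_mul, nsmul_eq_mul]
      rw [Finset.sum_eq_single i (fun l _ hl => by simp [hl]) (by simp)]
      simp
    have hev := (ContinuousLinearMap.apply ℂ ℂ (Pi.single i 1 : Fin d → ℂ)).map_tsum hsf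
    simp only [ContinuousLinearMap.apply_apply] at hev
    rw [_root_.pdC, heq.fderiv_eq, hF.fderiv, hev]
    simp only [happ]
    rw [← tsum_add_single i (fun n hn => by simp [hn])]
    refine tsum_congr fun n => ?_
    rw [prod_erase_add_single (fun l m => w l ^ m), ← Finset.mul_prod_erase _ _ (Finset.mem_univ i)]
    simp only [Pi.add_apply, Pi.single_eq_same, add_tsub_cancel_right, Nat.cast_add, Nat.cast_one]
    ring

theorem HasDominatedSeries.iterate_pdC {d : ℕ} {C : ℝ} {u : Fin d → ℕ → ℝ}
    {f : (Fin d → ℂ) → ℂ} (hf : HasDominatedSeries C u f)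
    (hu : ∀ l, RapidDecay (u l)) (i : Fin d) (k : ℕ) :
    HasDominatedSeries C (Function.update u i (coeffDeriv^[k] (u i))) ((_root_.pdC i)^[k] f) := by
  induction k with
  | zero => simpa using hf
  | succ k ih =>
    have hu' : ∀ l, RapidDecay (Function.update u i (coeffDeriv^[k] (u i)) l) := by
      intro l
      rcases eq_or_ne l i with rfl | hl
      · simpa using (hu l).iterate_coeffDeriv k
      · simpa [hl] using hu l
    have h := ih.pdC hu' i
    rwa [Function.update_idem, Function.update_self, ← Function.iterate_succ_apply' coeffDeriv,
      ← Function.iterate_succ_apply' (_root_.pdC i)] at h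

theorem HasDominatedSeries.foldr_pdC {d : ℕ} {C : ℝ} {u : Fin d → ℕ → ℝ}
    {f : (Fin d → ℂ) → ℂ} (hf : HasDominatedSeries C u f)
    (hu : ∀ l, RapidDecay (u l)) (p : Fin d → ℕ) (L : List (Fin d)) :
    HasDominatedSeries C (fun l => coeffDeriv^[p l * L.count l] (u l))
      (((L.map fun i => fun G => (_root_.pdC i)^[p i] G).foldr (· ∘ ·) id) f) := by
  induction L with
  | nil => simpa using hf
  | cons i L ih =>
    have h := ih.iterate_pdC (fun l => (hu l).iterate_coeffDeriv _) i (p i)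
    have hcount : (fun l => coeffDeriv^[p l * (i :: L).count l] (u l)) =
        Function.update (fun l => coeffDeriv^[p l * L.count l] (u l)) i
          (coeffDeriv^[p i] (coeffDeriv^[p i * L.count i] (u i))) := by
      funext l
      rcases eq_or_ne l i with rfl | hl
      · rw [Function.update_self, ← Function.iterate_add_apply, List.count_cons_self, mul_add_one,
          add_comm]
      · rw [Function.update_of_ne hl, List.count_cons_of_ne (Ne.symm hl)]
    rw [hcount]
    exact h

theorem HasDominatedSeries.mderivC {d : ℕ} {C : ℝ} {u : Fin d → ℕ → ℝ}
    {f : (Fin d → ℂ) → ℂ} (hf : HasDominatedSeries C u f)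
    (hu : ∀ l, RapidDecay (u l)) (p : Fin d → ℕ) :
    HasDominatedSeries C (fun l => coeffDeriv^[p l] (u l)) (mderivC p f) := by
  have h := hf.foldr_pdC hu p (List.finRange d)
  rw [← List.ofFn_eq_map] at h
  simp only [List.count_eq_one_of_mem (List.nodup_finRange d) (List.mem_finRange _), mul_one] at h
  exact h

theorem iterate_coeffDeriv_le {u : ℕ → ℝ} (hu : ∀ m, 0 ≤ u m) (p m : ℕ) :
    coeffDeriv^[p] u m ≤ ((m + p : ℕ) : ℝ) ^ p * u (m + p) := by
  induction p generalizing m with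
  | zero => simp
  | succ p ih =>
    rw [Function.iterate_succ_apply', coeffDeriv]
    calc ((m : ℝ) + 1) * coeffDeriv^[p] u (m + 1)
        ≤ ((m : ℝ) + 1) * (((m + 1 + p : ℕ) : ℝ) ^ p * u (m + 1 + p)) := by gcongr; exact ih _
      _ ≤ ((m + 1 + p : ℕ) : ℝ) * (((m + 1 + p : ℕ) : ℝ) ^ p * u (m + 1 + p)) := by
          refine mul_le_mul_of_nonneg_right ?_ (mul_nonneg (by positivity) (hu _))
          push_cast
          linarith [(Nat.cast_nonneg p : (0 : ℝ) ≤ p)]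
      _ = _ := by rw [add_right_comm m 1 p, add_assoc m p 1]; ring

theorem rpow_le_rpow_self_mul_exp {q y : ℝ} (hq : 0 ≤ q) (hy : 0 ≤ y) :
    y ^ q ≤ q ^ q * Real.exp y := by
  rcases hq.eq_or_lt with rfl | hq
  · simpa using hy
  · have h1 : y / q ≤ Real.exp (y / q) := by linarith [Real.add_one_le_exp (y / q)]
    calc y ^ q = (q * (y / q)) ^ q := by rw [mul_div_cancel₀ _ hq.ne']
      _ = q ^ q * (y / q) ^ q := Real.mul_rpow hq.le (by positivity)
      _ ≤ q ^ q * Real.exp (y / q) ^ q := by gcongr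
      _ = q ^ q * Real.exp y := by rw [← Real.exp_mul, div_mul_cancel₀ _ hq.ne']

theorem pow_mul_exp_neg_le {α s : ℝ} (hα : 1 ≤ α) (hs : 0 < s) (p m : ℕ) :
    (m : ℝ) ^ p * Real.exp (-(s * (m : ℝ) ^ (1 / α))) ≤
      ((α / s) ^ α) ^ p * (p : ℝ) ^ (α * (p : ℝ)) := by
  have hα0 : 0 < α := by linarith
  have hm : (0 : ℝ) ≤ m := m.cast_nonneg
  have hx : (0 : ℝ) ≤ (m : ℝ) ^ (1 / α) := Real.rpow_nonneg hm _
  have h := rpow_le_rpow_self_mul_exp (q := α * p) (y := s * (m : ℝ) ^ (1 / α))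
    (by positivity) (by positivity)
  have hmp : ((m : ℝ) ^ (1 / α)) ^ (α * (p : ℝ)) = (m : ℝ) ^ p := by
    rw [← Real.rpow_mul hm, ← mul_assoc, one_div, inv_mul_cancel₀ hα0.ne', one_mul,
      Real.rpow_natCast]
  rw [Real.mul_rpow hs.le hx, hmp, Real.mul_rpow hα0.le p.cast_nonneg] at h
  have hA : ((α / s) ^ α) ^ p = α ^ (α * (p : ℝ)) / s ^ (α * (p : ℝ)) := by
    rw [← Real.rpow_natCast, ← Real.rpow_mul (by positivity), Real.div_rpow hα0.le hs.le]
  have hsp : 0 < s ^ (α * (p : ℝ)) := Real.rpow_pos_of_pos hs _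
  rw [hA, Real.exp_neg, ← div_eq_mul_inv, div_le_iff₀ (Real.exp_pos _), div_mul_eq_mul_div,
    div_mul_eq_mul_div, le_div_iff₀ hsp]
  linarith

theorem pow_mul_exp_neg_le_mul_exp {α t : ℝ} (hα : 1 ≤ α) (ht : 0 < t) (p m : ℕ) :
    (m : ℝ) ^ p * Real.exp (-(t * (m : ℝ) ^ (1 / α))) ≤
      ((α / (t / 2)) ^ α) ^ p * (p : ℝ) ^ (α * (p : ℝ)) *
        Real.exp (-(t / 2 * (m : ℝ) ^ (1 / α))) := by
  have h := mul_le_mul_of_nonneg_right (pow_mul_exp_neg_le hα (half_pos ht) p m)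
    (Real.exp_pos (-(t / 2 * (m : ℝ) ^ (1 / α)))).le
  rwa [mul_assoc, ← Real.exp_add, ← neg_add, ← add_mul, add_halves] at h

theorem summable_exp_neg_rpow {α t : ℝ} (hα : 1 ≤ α) (ht : 0 < t) :
    Summable fun m : ℕ => Real.exp (-(t * (m : ℝ) ^ (1 / α))) := by
  have h : Summable fun m : ℕ => ((α / t) ^ α) ^ 2 * ((2 : ℕ) : ℝ) ^ (α * ((2 : ℕ) : ℝ)) *
      (1 / (m : ℝ) ^ 2) := (Real.summable_one_div_nat_pow.2 one_lt_two).mul_left _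
  refine Summable.of_norm_bounded_eventually_nat h ?_
  filter_upwards [eventually_gt_atTop 0] with m hm
  have hm' : (0 : ℝ) < (m : ℝ) ^ 2 := by positivity
  rw [Real.norm_of_nonneg (Real.exp_pos _).le, mul_one_div, le_div_iff₀ hm', mul_comm]
  exact pow_mul_exp_neg_le hα ht 2 m

theorem rapidDecay_exp_neg_rpow {α t : ℝ} (hα : 1 ≤ α) (ht : 0 < t) :
    RapidDecay fun m : ℕ => Real.exp (-(t * (m : ℝ) ^ (1 / α))) :=
  ⟨fun _ => (Real.exp_pos _).le, fun k =>
    Summable.of_nonneg_of_le (fun _ => by positivity) (pow_mul_exp_neg_le_mul_exp hα ht k)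
      ((summable_exp_neg_rpow hα (half_pos ht)).mul_left _)⟩

theorem exp_neg_rpow_le_mul_succ {α t : ℝ} (hα : 1 ≤ α) (ht : 0 < t) (m : ℕ) :
    Real.exp (-(t * (m : ℝ) ^ (1 / α))) ≤
      Real.exp t * Real.exp (-(t * ((m + 1 : ℕ) : ℝ) ^ (1 / α))) := by
  rw [← Real.exp_add, Real.exp_le_exp]
  have h := Real.rpow_add_le_add_rpow (p := 1 / α) (m.cast_nonneg (α := ℝ)) zero_le_one
    (by positivity) (div_le_one_of_le₀ hα (by linarith))
  rw [Real.one_rpow] at h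
  push_cast
  nlinarith

/-- Derivatives of a one-variable series with stretched-exponential coefficients have Gevrey
growth. -/
theorem tsum_iterate_coeffDeriv_le {α t : ℝ} (hα : 1 ≤ α) (ht : 0 < t) (p : ℕ) :
    ∑' m, coeffDeriv^[p] (fun m : ℕ => Real.exp (-(t * (m : ℝ) ^ (1 / α)))) m ≤
      (∑' m : ℕ, Real.exp (-(t / 2 * (m : ℝ) ^ (1 / α)))) * ((α / (t / 2)) ^ α) ^ p *
        (p : ℝ) ^ (α * (p : ℝ)) := by
  have hu := rapidDecay_exp_neg_rpow hα ht
  have hs := summable_exp_neg_rpow hα (half_pos ht)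
  have hα0 : 0 < α := by linarith
  calc _ ≤ ∑' m : ℕ, ((α / (t / 2)) ^ α) ^ p * (p : ℝ) ^ (α * (p : ℝ)) *
        Real.exp (-(t / 2 * (m : ℝ) ^ (1 / α))) := by
        refine (hu.iterate_coeffDeriv p).summable.tsum_le_tsum (fun m => ?_) (hs.mul_left _)
        refine (iterate_coeffDeriv_le hu.1 p m).trans
          ((pow_mul_exp_neg_le_mul_exp hα ht p (m + p)).trans ?_)
        gcongr
        exact Nat.le_add_right m p
    _ = _ := by rw [tsum_mul_left]; ring

/-- A stretched exponential in `|n|` is dominated by a product of one-variable ones. -/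
theorem rpow_neg_sum_rpow_le_prod {d : ℕ} {α b : ℝ} (hα : 1 ≤ α) (hb : 1 < b) (n : Fin d → ℕ) :
    b ^ (-((∑ l, (n l : ℝ)) ^ (1 / α))) ≤
      ∏ l, Real.exp (-(Real.log b / (d + 1) * (n l : ℝ) ^ (1 / α))) := by
  have hlog := Real.log_pos hb
  rw [Real.rpow_def_of_pos (by linarith), ← Real.exp_sum, Real.exp_le_exp,
    Finset.sum_neg_distrib, mul_neg, neg_le_neg_iff, ← Finset.mul_sum, div_mul_eq_mul_div,
    div_le_iff₀ (by positivity), mul_assoc]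
  refine mul_le_mul_of_nonneg_left ?_ hlog.le
  have hN : 0 ≤ (∑ l, (n l : ℝ)) ^ (1 / α) := by positivity
  calc ∑ l, (n l : ℝ) ^ (1 / α) ≤ ∑ _l : Fin d, (∑ l, (n l : ℝ)) ^ (1 / α) := by
        refine Finset.sum_le_sum fun l _ => ?_
        gcongr
        exact Finset.single_le_sum (f := fun l => (n l : ℝ)) (fun _ _ => Nat.cast_nonneg _)
          (Finset.mem_univ l)
    _ = d * (∑ l, (n l : ℝ)) ^ (1 / α) := by simp
    _ ≤ _ := by linarith

/-- For `α ≥ 1`: if `|a_n| ≤ c a^{−|n|^{1/α}}` for some `c > 0`, `a > 1`, then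
`|D^p F(w)| ≤ C A^{|p|} p^{αp}` on the polydisc for some `C, A > 0`. -/
theorem stmt13 {d : ℕ} (α : ℝ) (hα : 1 ≤ α) (a : (Fin d → ℕ) → ℂ)
    (c b : ℝ) (hc : 0 < c) (hb : 1 < b)
    (hdecay : ∀ n : Fin d → ℕ, ‖a n‖ ≤ c * b ^ (-((∑ l, (n l : ℝ)) ^ (1/α)))) :
    ∃ C > (0:ℝ), ∃ A > (0:ℝ), ∀ p : Fin d → ℕ, ∀ w ∈ Dpoly d,
      ‖mderivC p (Fser a) w‖ ≤
        C * A ^ (∑ l, p l) * ∏ l, ((p l : ℝ)) ^ (α * (p l : ℝ)) := by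
  set t := Real.log b / (d + 1) with ht_def
  have ht : 0 < t := div_pos (Real.log_pos hb) (by positivity)
  have hα0 : 0 < α := by linarith
  let u : Fin d → ℕ → ℝ := fun _ m => Real.exp (-(t * (m : ℝ) ^ (1 / α)))
  have hu : ∀ l, RapidDecay (u l) := fun _ => rapidDecay_exp_neg_rpow hα ht
  have hbase : HasDominatedSeries c u fun w => ∑' n : Fin d → ℕ, a n * ∏ l, w l ^ n l :=
    ⟨a, fun n => (hdecay n).trans
      (mul_le_mul_of_nonneg_left (rpow_neg_sum_rpow_le_prod hα hb n) hc.le), fun _ _ => rfl⟩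
  have hF : HasDominatedSeries (c * (1 + Real.exp t) ^ (univ : Finset (Fin d)).card) u (Fser a) :=
    hbase.prod_one_sub_mul hc.le hu (Real.exp_pos t).le
      (fun _ => exp_neg_rpow_le_mul_succ hα ht) univ
  set C := c * (1 + Real.exp t) ^ (univ : Finset (Fin d)).card
  have hC : 0 < C := by positivity
  set M := ∑' m : ℕ, Real.exp (-(t / 2 * (m : ℝ) ^ (1 / α)))
  have hM : 0 < M := (summable_exp_neg_rpow hα (half_pos ht)).tsum_pos
    (fun _ => (Real.exp_pos _).le) 0 (Real.exp_pos _)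
  refine ⟨C * M ^ d, by positivity, (α / (t / 2)) ^ α, by positivity, fun p w hw => ?_⟩
  refine ((hF.mderivC hu p).norm_le hC.le (fun l => (hu l).iterate_coeffDeriv _) hw).trans ?_
  calc C * ∏ l, ∑' m, coeffDeriv^[p l] (u l) m
      ≤ C * ∏ l, (M * ((α / (t / 2)) ^ α) ^ p l * (p l : ℝ) ^ (α * (p l : ℝ))) := by
        refine mul_le_mul_of_nonneg_left (Finset.prod_le_prod (fun l _ => ?_) fun l _ =>
          tsum_iterate_coeffDeriv_le hα ht (p l)) hC.le
        exact tsum_nonneg ((hu l).iterate_coeffDeriv _).1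
    _ = _ := by
        rw [Finset.prod_mul_distrib, Finset.prod_mul_distrib, Finset.prod_pow_eq_pow_sum,
          Finset.prod_const, Finset.card_univ, Fintype.card_fin]
        ring
end
end

section
/- Let σ ∈ S(ℝ^d₊) and let σ̄ denote the continuous extension of σ to [0,∞)^d. Define v: ℝ^{2d} → [0,∞)^d by v(x,ξ) = (x₁²+ξ₁², …, x_d²+ξ_d²). Then σ̃ = σ̄ ∘ v is a smooth function on ℝ^{2d} and belongs to the Schwartz space 𝒮(ℝ^{2d}); moreover, for every j ∈ ℕ there exists a constant C > 0 (independent of σ) such that sup over multi-indices p'', q'', p, q with |p''| ≤ j, |q''| ≤ j, |p| ≤ j, |q| ≤ j of sup_{(x,ξ)∈ℝ^{2d}} |x^{p''} ξ^{q''} D_x^p D_ξ^q σ̃(x,ξ)| is bounded by C · sup_{|n|≤2j, |m|≤2j} sup_{t∈ℝ^d₊} |t^m D^n σ(t)|. -/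
open MeasureTheory Filter Finset

noncomputable section

def Rpos (d : ℕ) : Set (Fin d → ℝ) := {x | ∀ i, 0 < x i}

def pd {d : ℕ} (i : Fin d) (f : (Fin d → ℝ) → ℂ) : (Fin d → ℝ) → ℂ :=
  fun x => fderiv ℝ f x (Pi.single i 1)

def mderiv {d : ℕ} (p : Fin d → ℕ) (f : (Fin d → ℝ) → ℂ) : (Fin d → ℝ) → ℂ :=
  ((List.ofFn fun i : Fin d => (fun g => (pd i)^[p i] g)).foldr (· ∘ ·) id) f

/-- The space `S(ℝ^d₊)`. -/
def IsSPlus {d : ℕ} (f : (Fin d → ℝ) → ℂ) : Prop :=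
  ContDiffOn ℝ (⊤ : ℕ∞) f (Rpos d) ∧
  (∀ p : Fin d → ℕ, ∃ g : (Fin d → ℝ) → ℂ,
    ContinuousOn g {x | ∀ i, 0 ≤ x i} ∧ ∀ x ∈ Rpos d, g x = mderiv p f x) ∧
  (∀ k p : Fin d → ℕ, ∃ C : ℝ, ∀ x ∈ Rpos d,
    (∏ i, x i ^ k i) * ‖mderiv p f x‖ ≤ C)

/-- `ℝ^{2d}` realized as pairs `(x,ξ)`. -/
abbrev EE (d : ℕ) := (Fin d → ℝ) × (Fin d → ℝ)

/-- `v(x,ξ) = (x₁²+ξ₁², …, x_d²+ξ_d²)`. -/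
def vmap {d : ℕ} (z : EE d) : Fin d → ℝ := fun l => (z.1 l)^2 + (z.2 l)^2

/-- Partial derivative on `ℝ^{2d}` in the `i`-th `x`-direction. -/
def pdx {d : ℕ} (i : Fin d) (F : EE d → ℂ) : EE d → ℂ :=
  fun z => fderiv ℝ F z (Pi.single i 1, 0)

/-- Partial derivative on `ℝ^{2d}` in the `i`-th `ξ`-direction. -/
def pdxi {d : ℕ} (i : Fin d) (F : EE d → ℂ) : EE d → ℂ :=
  fun z => fderiv ℝ F z (0, Pi.single i 1)

/-- Mixed multi-index derivative `D_x^p D_ξ^q F`. -/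
def mderiv2 {d : ℕ} (p q : Fin d → ℕ) (F : EE d → ℂ) : EE d → ℂ :=
  ((List.ofFn fun i : Fin d => (fun G => (pdx i)^[p i] G)).foldr (· ∘ ·) id)
    (((List.ofFn fun i : Fin d => (fun G => (pdxi i)^[q i] G)).foldr (· ∘ ·) id) F)

theorem isOpen_Rpos (d : ℕ) : IsOpen (Rpos d) := by
  have : Rpos d = Set.univ.pi fun _ => Set.Ioi 0 := by ext; simp [Rpos]
  exact this ▸ isOpen_set_pi Set.finite_univ fun _ _ => isOpen_Ioi

theorem closure_Rpos (d : ℕ) : closure (Rpos d) = {x | ∀ i, 0 ≤ x i} := by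
  have : Rpos d = Set.univ.pi fun _ => Set.Ioi 0 := by ext; simp [Rpos]
  rw [this, closure_pi_set]
  ext
  simp [Pi.le_def]

theorem convex_Rpos (d : ℕ) : Convex ℝ (Rpos d) := by
  have : Rpos d = Set.univ.pi fun _ => Set.Ioi 0 := by ext; simp [Rpos]
  exact this ▸ convex_pi fun _ _ => convex_Ioi 0

section PartialDerivatives

variable {d : ℕ} {s : Set (Fin d → ℝ)} {f g : (Fin d → ℝ) → ℂ}

theorem Set.EqOn.pd (hs : IsOpen s) (h : Set.EqOn f g s) (i : Fin d) :
    Set.EqOn (pd i f) (pd i g) s := fun x hx => by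
  simp only [_root_.pd, (h.eventuallyEq_of_mem (hs.mem_nhds hx)).fderiv_eq]

theorem Set.EqOn.iterate_pd (hs : IsOpen s) (h : Set.EqOn f g s) (i : Fin d) (k : ℕ) :
    Set.EqOn ((_root_.pd i)^[k] f) ((_root_.pd i)^[k] g) s := by
  induction k with
  | zero => exact h
  | succ k ih =>
    simp only [Function.iterate_succ_apply']
    exact ih.pd hs i

theorem ContDiffOn.pd (hs : IsOpen s) (h : ContDiffOn ℝ (⊤ : ℕ∞) f s) (i : Fin d) :
    ContDiffOn ℝ (⊤ : ℕ∞) (_root_.pd i f) s :=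
  (h.fderiv_of_isOpen hs (m := (⊤ : ℕ∞)) (by simp)).clm_apply contDiffOn_const

theorem ContDiffOn.iterate_pd (hs : IsOpen s) (h : ContDiffOn ℝ (⊤ : ℕ∞) f s) (i : Fin d)
    (k : ℕ) : ContDiffOn ℝ (⊤ : ℕ∞) ((_root_.pd i)^[k] f) s := by
  induction k with
  | zero => exact h
  | succ k ih =>
    rw [Function.iterate_succ_apply']
    exact ih.pd hs i

theorem pd_comm (hs : IsOpen s) (h : ContDiffOn ℝ (⊤ : ℕ∞) f s) (i j : Fin d) :
    Set.EqOn (pd i (pd j f)) (pd j (pd i f)) s := fun x hx => by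
  have hx' := hs.mem_nhds hx
  have hd : DifferentiableAt ℝ (fderiv ℝ f) x :=
    ((h.fderiv_of_isOpen hs (m := (⊤ : ℕ∞)) (by simp)).contDiffAt hx').differentiableAt (by simp)
  have hsymm : IsSymmSndFDerivAt ℝ f x :=
    (h.contDiffAt hx').isSymmSndFDerivAt (by
      rw [minSmoothness_of_isRCLikeNormedField]; exact WithTop.coe_le_coe.mpr le_top)
  have key (a b : Fin d) :
      pd a (pd b f) x = fderiv ℝ (fderiv ℝ f) x (Pi.single a 1) (Pi.single b 1) := by
    unfold pd
    rw [fderiv_clm_apply hd (differentiableAt_const _)]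
    simp
  rw [key, key, hsymm.eq]

theorem pd_iterate_comm (hs : IsOpen s) (h : ContDiffOn ℝ (⊤ : ℕ∞) f s) (i j : Fin d) (k : ℕ) :
    Set.EqOn (pd i ((pd j)^[k] f)) ((pd j)^[k] (pd i f)) s := by
  induction k with
  | zero => exact fun _ _ => rfl
  | succ k ih =>
    simp only [Function.iterate_succ_apply']
    exact (pd_comm hs (h.iterate_pd hs j k) i j).trans (ih.pd hs j)

/-- Iterated partial derivatives, of order `p i` in each of the listed directions `i`. -/
def mderivList (l : List (Fin d)) (p : Fin d → ℕ) (f : (Fin d → ℝ) → ℂ) : (Fin d → ℝ) → ℂ :=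
  l.foldr (fun i g => (pd i)^[p i] g) f

theorem foldr_comp_map {α β : Type*} (φ : β → α → α) (l : List β) (a : α) :
    (l.map φ).foldr (· ∘ ·) id a = l.foldr φ a := by
  induction l with
  | nil => rfl
  | cons b l ih => simp only [List.map_cons, List.foldr_cons, Function.comp_apply, ih]

theorem mderiv_eq_mderivList (p : Fin d → ℕ) (f : (Fin d → ℝ) → ℂ) :
    mderiv p f = mderivList (List.finRange d) p f := by
  rw [mderiv, List.ofFn_eq_map, foldr_comp_map]
  rfl

theorem ContDiffOn.mderivList (hs : IsOpen s) (h : ContDiffOn ℝ (⊤ : ℕ∞) f s)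
    (l : List (Fin d)) (p : Fin d → ℕ) :
    ContDiffOn ℝ (⊤ : ℕ∞) (_root_.mderivList l p f) s := by
  induction l with
  | nil => exact h
  | cons j l ih => exact ih.iterate_pd hs j (p j)

theorem mderivList_congr {l : List (Fin d)} {p q : Fin d → ℕ} (h : ∀ i ∈ l, p i = q i)
    (f : (Fin d → ℝ) → ℂ) : mderivList l p f = mderivList l q f := by
  induction l with
  | nil => rfl
  | cons j l ih =>
    simp only [mderivList, List.foldr_cons] at ih ⊢
    rw [ih fun i hi => h i (List.mem_cons_of_mem _ hi), h j List.mem_cons_self]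

theorem pd_mderivList (hs : IsOpen s) (h : ContDiffOn ℝ (⊤ : ℕ∞) f s) {l : List (Fin d)}
    (hl : l.Nodup) (p : Fin d → ℕ) {i : Fin d} (hi : i ∈ l) :
    Set.EqOn (pd i (mderivList l p f)) (mderivList l (p + Pi.single i 1) f) s := by
  induction l with
  | nil => simp at hi
  | cons j l ih =>
    rw [List.nodup_cons] at hl
    by_cases hij : i = j
    · subst hij
      have : mderivList l (p + Pi.single i 1) f = mderivList l p f :=
        mderivList_congr (fun k hk => by
          have : k ≠ i := fun hki => hl.1 (hki ▸ hk)
          simp [this]) f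
      unfold mderivList at this ⊢
      rw [List.foldr_cons, List.foldr_cons, this]
      simp only [Pi.add_apply, Pi.single_eq_same, Function.iterate_succ_apply']
      exact fun _ _ => rfl
    · have hp : (p + (Pi.single i 1 : Fin d → ℕ)) j = p j := by simp [Ne.symm hij]
      have hil : i ∈ l := (List.mem_cons.mp hi).resolve_left hij
      have h₁ := pd_iterate_comm hs (h.mderivList hs l p) i j (p j)
      have h₂ := (ih hl.2 hil).iterate_pd hs j (p j)
      have h₃ := h₁.trans h₂
      unfold mderivList at h₃ ⊢
      rw [List.foldr_cons, List.foldr_cons, hp]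
      exact h₃

theorem ContDiffOn.mderiv (hs : IsOpen s) (h : ContDiffOn ℝ (⊤ : ℕ∞) f s) (p : Fin d → ℕ) :
    ContDiffOn ℝ (⊤ : ℕ∞) (_root_.mderiv p f) s :=
  mderiv_eq_mderivList p f ▸ h.mderivList hs _ p

theorem pd_mderiv (hs : IsOpen s) (h : ContDiffOn ℝ (⊤ : ℕ∞) f s) (p : Fin d → ℕ) (i : Fin d) :
    Set.EqOn (pd i (mderiv p f)) (mderiv (p + Pi.single i 1) f) s := by
  rw [mderiv_eq_mderivList, mderiv_eq_mderivList]
  exact pd_mderivList hs h (List.nodup_finRange d) p (List.mem_finRange i)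

theorem mderiv_zero (f : (Fin d → ℝ) → ℂ) : mderiv 0 f = f := by
  rw [mderiv_eq_mderivList, mderivList]
  induction List.finRange d with
  | nil => rfl
  | cons j l ih => rw [List.foldr_cons, ih]; rfl

end PartialDerivatives

/-- A jet on the closed orthant: `g (n + eᵢ)` is the `i`-th partial derivative of `g n`. -/
def IsJet {d : ℕ} (g : (Fin d → ℕ) → (Fin d → ℝ) → ℂ) : Prop :=
  ∀ n, ∀ t ∈ closure (Rpos d), HasFDerivWithinAt (g n)
    (∑ i, (ContinuousLinearMap.proj i : (Fin d → ℝ) →L[ℝ] ℝ).smulRight (g (n + Pi.single i 1) t))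
    (closure (Rpos d)) t

theorem IsSPlus.isJet {d : ℕ} {σ : (Fin d → ℝ) → ℂ} (hσ : IsSPlus σ)
    {g : (Fin d → ℕ) → (Fin d → ℝ) → ℂ} (hc : ∀ n, ContinuousOn (g n) (closure (Rpos d)))
    (hg : ∀ n, Set.EqOn (g n) (mderiv n σ) (Rpos d)) : IsJet g := by
  intro n t ht
  have ho := isOpen_Rpos d
  have hsm := (hσ.1.mderiv ho n).congr (hg n)
  refine hasFDerivWithinAt_closure_of_tendsto_fderiv (hsm.differentiableOn (by simp))
    (convex_Rpos d) ho (fun y hy => (hc n y hy).mono subset_closure) ?_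
  have hlim : Tendsto (fun y => ∑ i, (ContinuousLinearMap.proj i :
      (Fin d → ℝ) →L[ℝ] ℝ).smulRight (g (n + Pi.single i 1) y)) (nhdsWithin t (Rpos d))
      (nhds (∑ i, (ContinuousLinearMap.proj i :
        (Fin d → ℝ) →L[ℝ] ℝ).smulRight (g (n + Pi.single i 1) t))) := by
    refine tendsto_finsetSum _ fun i _ => ?_
    have := ((hc (n + Pi.single i 1) t ht).mono subset_closure).tendsto
    exact ((ContinuousLinearMap.smulRightL ℝ (Fin d → ℝ) ℂ
      (ContinuousLinearMap.proj i)).continuous.tendsto _).comp this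
  refine hlim.congr' ?_
  filter_upwards [self_mem_nhdsWithin] with y hy
  have hpd (i : Fin d) : fderiv ℝ (g n) y (Pi.single i 1) = g (n + Pi.single i 1) y := by
    rw [hg _ hy, ← pd_mderiv ho hσ.1 n i hy, ← (hg n).pd ho i hy, pd]
  ext v
  conv_rhs => rw [← Finset.univ_sum_single v, map_sum]
  simp only [_root_.sum_apply, ContinuousLinearMap.smulRight_apply,
    ContinuousLinearMap.proj_apply]
  refine Finset.sum_congr rfl fun i _ => ?_
  have : (Pi.single i (v i) : Fin d → ℝ) = v i • Pi.single i 1 := by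
    rw [← Pi.single_smul, smul_eq_mul, mul_one]
  rw [this, map_smul, hpd]

section Coordinates

variable {d : ℕ}

/-- The basis vectors of `EE d`: `Sum.inl i` stands for the `i`-th `x`-direction and `Sum.inr i`
for the `i`-th `ξ`-direction. -/
def unitVec (s : Fin d ⊕ Fin d) : EE d :=
  s.elim (fun i => (Pi.single i 1, 0)) (fun i => (0, Pi.single i 1))

/-- The coordinates on `EE d`. -/
def coord (s : Fin d ⊕ Fin d) : EE d →L[ℝ] ℝ :=
  s.elim (fun i => (ContinuousLinearMap.proj i).comp (ContinuousLinearMap.fst ℝ _ _))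
    (fun i => (ContinuousLinearMap.proj i).comp (ContinuousLinearMap.snd ℝ _ _))

/-- The component of `vmap` that depends on the given coordinate. -/
def component (s : Fin d ⊕ Fin d) : Fin d := s.elim id id

/-- Directional derivative along a basis vector of `EE d`. -/
def pdir (s : Fin d ⊕ Fin d) (F : EE d → ℂ) : EE d → ℂ := fun z => fderiv ℝ F z (unitVec s)

theorem sum_coord_smul_unitVec (w : EE d) : ∑ s, coord s w • unitVec s = w := by
  rw [Fintype.sum_sum_type]
  ext i
  · simp [coord, unitVec, Prod.fst_sum, Finset.sum_apply, Pi.single_apply]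
  · simp [coord, unitVec, Prod.snd_sum, Finset.sum_apply, Pi.single_apply]

theorem fderiv_eq_sum_pdir (F : EE d → ℂ) (z : EE d) :
    fderiv ℝ F z = ∑ s, (coord s).smulRight (pdir s F z) := by
  refine ContinuousLinearMap.ext fun w => ?_
  conv_lhs => rw [← sum_coord_smul_unitVec w]
  simp only [map_sum, map_smul, _root_.sum_apply, ContinuousLinearMap.smulRight_apply, pdir]

theorem abs_coord_le_norm (s : Fin d ⊕ Fin d) (z : EE d) : |coord s z| ≤ ‖z‖ := by
  rcases s with i | i
  · exact (norm_le_pi_norm z.1 i).trans (norm_fst_le z)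
  · exact (norm_le_pi_norm z.2 i).trans (norm_snd_le z)

/-- A family of functions `G n` on `EE d` obeying the chain rule for compositions with `vmap`. -/
def IsLadder (G : (Fin d → ℕ) → EE d → ℂ) : Prop :=
  (∀ n, ContDiff ℝ (⊤ : ℕ∞) (G n)) ∧
    ∀ n s z, pdir s (G n) z = ((2 * coord s z : ℝ) : ℂ) * G (n + Pi.single (component s) 1) z

theorem vmap_mem_closure (z : EE d) : vmap z ∈ closure (Rpos d) := by
  rw [closure_Rpos]
  exact fun i => by unfold vmap; positivity

theorem hasFDerivAt_vmap (z : EE d) :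
    HasFDerivAt (vmap : EE d → Fin d → ℝ) (ContinuousLinearMap.pi fun i =>
      (2 * z.1 i) • coord (Sum.inl i) + (2 * z.2 i) • coord (Sum.inr i)) z := by
  rw [hasFDerivAt_pi]
  intro i
  have h₁ := ((coord (Sum.inl i)).hasFDerivAt (x := z)).pow 2
  have h₂ := ((coord (Sum.inr i)).hasFDerivAt (x := z)).pow 2
  convert! h₁.add h₂ using 1
  ext w <;> simp [coord]

theorem IsJet.hasFDerivAt_comp_vmap {g : (Fin d → ℕ) → (Fin d → ℝ) → ℂ} (hg : IsJet g)
    (n : Fin d → ℕ) (z : EE d) :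
    HasFDerivAt (fun y => g n (vmap y))
      (∑ i, ((2 * z.1 i) • coord (Sum.inl i) + (2 * z.2 i) • coord (Sum.inr i)).smulRight
        (g (n + Pi.single i 1) (vmap z))) z := by
  have h := (hg n _ (vmap_mem_closure z)).comp_hasFDerivAt z (hasFDerivAt_vmap z)
    (Eventually.of_forall vmap_mem_closure)
  convert! h using 1
  refine ContinuousLinearMap.ext fun w => ?_
  simp

theorem IsJet.isLadder {g : (Fin d → ℕ) → (Fin d → ℝ) → ℂ} (hg : IsJet g) :
    IsLadder fun n z => g n (vmap z) := by
  refine ⟨fun n => contDiff_infty.mpr fun k => ?_, fun n s z => ?_⟩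
  · induction k generalizing n with
    | zero =>
      exact contDiff_zero.mpr (continuous_iff_continuousAt.mpr
        fun z => (hg.hasFDerivAt_comp_vmap n z).continuousAt)
    | succ k ih =>
      refine contDiff_succ_iff_hasFDerivAt.mpr ⟨_, ?_, hg.hasFDerivAt_comp_vmap n⟩
      refine ContDiff.sum fun i _ => ContDiff.smulRight ?_ (ih _)
      fun_prop
  · rw [pdir, (hg.hasFDerivAt_comp_vmap n z).fderiv]
    rcases s with i | i
    · rw [_root_.sum_apply, Finset.sum_eq_single i]
      · simp [coord, unitVec, component]
      · intro j _ hj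
        simp [coord, unitVec, hj]
      · simp
    · rw [_root_.sum_apply, Finset.sum_eq_single i]
      · simp [coord, unitVec, component]
      · intro j _ hj
        simp [coord, unitVec, hj]
      · simp

/-- Linear combinations of products of at most `a` coordinates with some `G n`, `|n| ≤ b`,
as operators on families `G`. -/
inductive LadderExpr : ℕ → ℕ → (((Fin d → ℕ) → EE d → ℂ) → EE d → ℂ) → Prop
  | base {a b : ℕ} (n : Fin d → ℕ) (hn : ∑ i, n i ≤ b) : LadderExpr a b fun G => G n
  | coord_mul {a b : ℕ} {Φ : ((Fin d → ℕ) → EE d → ℂ) → EE d → ℂ} (s : Fin d ⊕ Fin d)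
      (h : LadderExpr a b Φ) : LadderExpr (a + 1) b fun G z => (coord s z : ℂ) * Φ G z
  | const_mul {a b : ℕ} {Φ : ((Fin d → ℕ) → EE d → ℂ) → EE d → ℂ} (c : ℂ)
      (h : LadderExpr a b Φ) : LadderExpr a b fun G z => c * Φ G z
  | add {a b : ℕ} {Φ Ψ : ((Fin d → ℕ) → EE d → ℂ) → EE d → ℂ} (h₁ : LadderExpr a b Φ)
      (h₂ : LadderExpr a b Ψ) : LadderExpr a b fun G z => Φ G z + Ψ G z

namespace LadderExpr

variable {a b : ℕ} {Φ : ((Fin d → ℕ) → EE d → ℂ) → EE d → ℂ}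
  {G : (Fin d → ℕ) → EE d → ℂ}

theorem mono (h : LadderExpr a b Φ) {a' b' : ℕ} (ha : a ≤ a') (hb : b ≤ b') :
    LadderExpr a' b' Φ := by
  induction h generalizing a' with
  | base n hn => exact base n (hn.trans hb)
  | coord_mul s _ ih =>
    obtain ⟨c, rfl⟩ := Nat.exists_eq_add_of_le' ha
    exact coord_mul s (ih (by lia) hb)
  | const_mul c _ ih => exact const_mul c (ih ha hb)
  | add _ _ ih₁ ih₂ => exact add (ih₁ ha hb) (ih₂ ha hb)

theorem contDiff (h : LadderExpr a b Φ) (hG : IsLadder G) : ContDiff ℝ (⊤ : ℕ∞) (Φ G) := by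
  induction h with
  | base n _ => exact hG.1 n
  | coord_mul s _ ih =>
    exact (Complex.ofRealCLM.contDiff.comp (coord s).contDiff).mul ih
  | const_mul c _ ih => exact contDiff_const.mul ih
  | add _ _ ih₁ ih₂ => exact ih₁.add ih₂

theorem exists_pdir (h : LadderExpr a b Φ) (s : Fin d ⊕ Fin d) :
    ∃ Ψ, LadderExpr (a + 1) (b + 1) Ψ ∧ ∀ G, IsLadder G → pdir s (Φ G) = Ψ G := by
  induction h with
  | @base a b n hn =>
    refine ⟨_, const_mul 2 (coord_mul s (base (n + Pi.single (component s) 1) ?_)),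
      fun G hG => ?_⟩
    · simpa [Finset.sum_add_distrib] using hn
    · ext z
      rw [hG.2]
      push_cast
      ring
  | @coord_mul a b Φ t h ih =>
    obtain ⟨Ψ, hΨ, hd⟩ := ih
    refine ⟨_, add (const_mul (coord t (unitVec s))
      (h.mono (a' := a + 1 + 1) (by lia) (Nat.le_succ _))) (coord_mul t hΨ), fun G hG => ?_⟩
    ext z
    have h₁ : HasFDerivAt (fun z : EE d => (coord t z : ℂ))
        (Complex.ofRealCLM.comp (coord t)) z :=
      (Complex.ofRealCLM.comp (coord t)).hasFDerivAt
    have h₂ := ((h.contDiff hG).differentiable (by simp) z).hasFDerivAt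
    rw [← hd G hG, pdir, (h₁.fun_mul h₂).fderiv]
    simp [pdir]
    ring
  | @const_mul a b Φ c h ih =>
    obtain ⟨Ψ, hΨ, hd⟩ := ih
    refine ⟨_, const_mul c hΨ, fun G hG => ?_⟩
    ext z
    have h₂ := ((h.contDiff hG).differentiable (by simp) z).hasFDerivAt
    rw [← hd G hG, pdir, (h₂.const_mul c).fderiv]
    simp [pdir]
  | @add a b Φ₁ Φ₂ h₁ h₂ ih₁ ih₂ =>
    obtain ⟨Ψ₁, hΨ₁, hd₁⟩ := ih₁
    obtain ⟨Ψ₂, hΨ₂, hd₂⟩ := ih₂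
    refine ⟨_, add hΨ₁ hΨ₂, fun G hG => ?_⟩
    ext z
    have h₁' := ((h₁.contDiff hG).differentiable (by simp) z).hasFDerivAt
    have h₂' := ((h₂.contDiff hG).differentiable (by simp) z).hasFDerivAt
    rw [← hd₁ G hG, ← hd₂ G hG, pdir, (h₁'.fun_add h₂').fderiv]
    simp [pdir]

theorem exists_iterate_pdir (h : LadderExpr a b Φ) (s : Fin d ⊕ Fin d) (k : ℕ) :
    ∃ Ψ, LadderExpr (a + k) (b + k) Ψ ∧ ∀ G, IsLadder G → (pdir s)^[k] (Φ G) = Ψ G := by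
  induction k with
  | zero => exact ⟨Φ, h, fun _ _ => rfl⟩
  | succ k ih =>
    obtain ⟨Ψ, hΨ, hd⟩ := ih
    obtain ⟨Ψ', hΨ', hd'⟩ := hΨ.exists_pdir s
    refine ⟨Ψ', hΨ', fun G hG => ?_⟩
    rw [Function.iterate_succ_apply', hd G hG, hd' G hG]

theorem exists_foldr_pdir (h : LadderExpr a b Φ) (e : Fin d → Fin d ⊕ Fin d) (p : Fin d → ℕ)
    (l : List (Fin d)) :
    ∃ Ψ, LadderExpr (a + (l.map p).sum) (b + (l.map p).sum) Ψ ∧ ∀ G, IsLadder G →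
      l.foldr (fun i F => (pdir (e i))^[p i] F) (Φ G) = Ψ G := by
  induction l with
  | nil => exact ⟨Φ, h, fun _ _ => rfl⟩
  | cons j l ih =>
    obtain ⟨Ψ, hΨ, hd⟩ := ih
    obtain ⟨Ψ', hΨ', hd'⟩ := hΨ.exists_iterate_pdir (e j) (p j)
    refine ⟨Ψ', ?_, fun G hG => ?_⟩
    · rw [List.map_cons, List.sum_cons, add_comm (p j), ← add_assoc, ← add_assoc]
      exact hΨ'
    · rw [List.foldr_cons, hd G hG, hd' G hG]

theorem exists_mderiv2 (h : LadderExpr a b Φ) (p q : Fin d → ℕ) :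
    ∃ Ψ, LadderExpr (a + ∑ i, q i + ∑ i, p i) (b + ∑ i, q i + ∑ i, p i) Ψ ∧
      ∀ G, IsLadder G → mderiv2 p q (Φ G) = Ψ G := by
  obtain ⟨Ψ, hΨ, hd⟩ := h.exists_foldr_pdir Sum.inr q (List.finRange d)
  obtain ⟨Ψ', hΨ', hd'⟩ := hΨ.exists_foldr_pdir Sum.inl p (List.finRange d)
  have hsum (r : Fin d → ℕ) : ((List.finRange d).map r).sum = ∑ i, r i := by
    rw [← List.ofFn_eq_map, List.sum_ofFn]
  rw [hsum, hsum] at hΨ'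
  refine ⟨Ψ', hΨ', fun G hG => ?_⟩
  rw [← hd' G hG, ← hd G hG, mderiv2, List.ofFn_eq_map, List.ofFn_eq_map, foldr_comp_map,
    foldr_comp_map]
  rfl

theorem exists_norm_le (h : LadderExpr a b Φ) :
    ∃ C : ℝ, 0 ≤ C ∧ ∀ (G : (Fin d → ℕ) → EE d → ℂ) (z : EE d) (R N : ℝ), 1 ≤ R →
      (∀ s, |coord s z| ≤ R) → (∀ n : Fin d → ℕ, ∑ i, n i ≤ b → ‖G n z‖ ≤ N) →
      ‖Φ G z‖ ≤ C * R ^ a * N := by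
  induction h with
  | @base a b n hn =>
    refine ⟨1, zero_le_one, fun G z R N hR _ hN => ?_⟩
    have h₁ : ‖G n z‖ ≤ N := hN n hn
    have h₂ : 1 ≤ R ^ a := one_le_pow₀ hR
    nlinarith [norm_nonneg (G n z)]
  | @coord_mul a b Φ s _ ih =>
    obtain ⟨C, hC, hb⟩ := ih
    refine ⟨C, hC, fun G z R N hR hz hN => ?_⟩
    calc ‖(coord s z : ℂ) * Φ G z‖ = |coord s z| * ‖Φ G z‖ := by simp
      _ ≤ R * (C * R ^ a * N) :=
        mul_le_mul (hz s) (hb G z R N hR hz hN) (norm_nonneg _) (zero_le_one.trans hR)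
      _ = C * R ^ (a + 1) * N := by ring
  | @const_mul a b Φ c _ ih =>
    obtain ⟨C, hC, hb⟩ := ih
    refine ⟨‖c‖ * C, by positivity, fun G z R N hR hz hN => ?_⟩
    calc ‖c * Φ G z‖ = ‖c‖ * ‖Φ G z‖ := norm_mul _ _
      _ ≤ ‖c‖ * (C * R ^ a * N) := by gcongr; exact hb G z R N hR hz hN
      _ = ‖c‖ * C * R ^ a * N := by ring
  | @add a b Φ Ψ _ _ ih₁ ih₂ =>
    obtain ⟨C₁, hC₁, hb₁⟩ := ih₁
    obtain ⟨C₂, hC₂, hb₂⟩ := ih₂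
    refine ⟨C₁ + C₂, by positivity, fun G z R N hR hz hN => ?_⟩
    calc ‖Φ G z + Ψ G z‖ ≤ ‖Φ G z‖ + ‖Ψ G z‖ := norm_add_le _ _
      _ ≤ C₁ * R ^ a * N + C₂ * R ^ a * N :=
        add_le_add (hb₁ G z R N hR hz hN) (hb₂ G z R N hR hz hN)
      _ = (C₁ + C₂) * R ^ a * N := by ring

theorem exists_pow_mul_norm_le (h : LadderExpr a b Φ) :
    ∃ C : ℝ, 0 ≤ C ∧ ∀ (G : (Fin d → ℕ) → EE d → ℂ) (z : EE d) (N : ℝ) (k l : ℕ),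
      a + l ≤ 2 * k → (∀ n : Fin d → ℕ, ∑ i, n i ≤ b → (max 1 ‖z‖) ^ (2 * k) * ‖G n z‖ ≤ N) →
      (max 1 ‖z‖) ^ l * ‖Φ G z‖ ≤ C * N := by
  obtain ⟨C, hC, hb⟩ := h.exists_norm_le
  refine ⟨C, hC, fun G z N k l hkl hN => ?_⟩
  set R := max 1 ‖z‖
  have hR : 1 ≤ R := le_max_left _ _
  have hR₀ : 0 < R := zero_lt_one.trans_le hR
  have hN₀ : 0 ≤ N := le_trans (by positivity) (hN 0 (by simp))
  have h₁ := hb G z R (N / R ^ (2 * k)) hR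
    (fun s => (abs_coord_le_norm s z).trans (le_max_right _ _))
    fun n hn => by
      rw [le_div_iff₀ (by positivity), mul_comm]
      exact hN n hn
  calc R ^ l * ‖Φ G z‖ ≤ R ^ l * (C * R ^ a * (N / R ^ (2 * k))) := by gcongr
    _ = C * N * (R ^ (a + l) / R ^ (2 * k)) := by rw [pow_add]; ring
    _ ≤ C * N * 1 := by
        gcongr
        exact div_le_one_of_le₀ (pow_le_pow_right₀ hR hkl) (by positivity)
    _ = C * N := mul_one _

theorem exists_iteratedFDeriv_decay (h : LadderExpr a b Φ) (hG : IsLadder G)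
    (hdecay : ∀ n k, ∃ N : ℝ, ∀ z, (max 1 ‖z‖) ^ (2 * k) * ‖G n z‖ ≤ N) (l r : ℕ) :
    ∃ K : ℝ, ∀ z, ‖z‖ ^ l * ‖iteratedFDeriv ℝ r (Φ G) z‖ ≤ K := by
  induction r generalizing a b Φ with
  | zero =>
    obtain ⟨C, -, hC⟩ := h.exists_pow_mul_norm_le
    choose N hN using fun n => hdecay n (a + l)
    have hN₀ (n) : 0 ≤ N n := le_trans (by positivity) (hN n 0)
    refine ⟨C * ∑ n ∈ Fintype.piFinset fun _ => Finset.range (b + 1), N n, fun z => ?_⟩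
    rw [norm_iteratedFDeriv_zero]
    have hz : ‖z‖ ^ l * ‖Φ G z‖ ≤ (max 1 ‖z‖) ^ l * ‖Φ G z‖ := by
      gcongr
      exact le_max_right _ _
    refine hz.trans (hC G z _ (a + l) l (by lia) fun n hn => (hN n z).trans ?_)
    refine Finset.single_le_sum (f := N) (fun n _ => hN₀ n) (Fintype.mem_piFinset.mpr fun i => ?_)
    have : n i ≤ ∑ i, n i := Finset.single_le_sum (fun _ _ => Nat.zero_le _) (Finset.mem_univ i)
    exact Finset.mem_range.mpr (by lia)
  | succ r ih =>
    choose Ψ hΨ hd using h.exists_pdir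
    choose K hK using fun s => ih (hΨ s)
    let L (s : Fin d ⊕ Fin d) : ℂ →L[ℝ] EE d →L[ℝ] ℂ :=
      ContinuousLinearMap.smulRightL ℝ (EE d) ℂ (coord s)
    have hsm (s : Fin d ⊕ Fin d) : ContDiff ℝ r (Ψ s G) :=
      ((hΨ s).contDiff hG).of_le (mod_cast le_top)
    have hf : fderiv ℝ (Φ G) = fun z => ∑ s, (L s ∘ Ψ s G) z := by
      ext1 z
      rw [fderiv_eq_sum_pdir]
      refine Finset.sum_congr rfl fun s _ => ?_
      rw [hd s G hG]
      rfl
    refine ⟨∑ s, ‖L s‖ * K s, fun z => ?_⟩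
    rw [← norm_iteratedFDeriv_fderiv, hf, iteratedFDeriv_fun_sum_apply
      fun s _ => ((L s).contDiff.comp (hsm s)).contDiffAt]
    calc ‖z‖ ^ l * ‖∑ s, iteratedFDeriv ℝ r (L s ∘ Ψ s G) z‖
        ≤ ‖z‖ ^ l * ∑ s, ‖L s‖ * ‖iteratedFDeriv ℝ r (Ψ s G) z‖ := by
          gcongr
          refine (norm_sum_le _ _).trans (Finset.sum_le_sum fun s _ => ?_)
          exact (L s).norm_iteratedFDeriv_comp_left (hsm s).contDiffAt le_rfl
      _ = ∑ s, ‖L s‖ * (‖z‖ ^ l * ‖iteratedFDeriv ℝ r (Ψ s G) z‖) := by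
          rw [Finset.mul_sum]
          exact Finset.sum_congr rfl fun s _ => by ring
      _ ≤ ∑ s, ‖L s‖ * K s := by
          gcongr with s
          exact hK s z

end LadderExpr

theorem pow_max_one_norm_le (z : EE d) (k : ℕ) :
    (max 1 ‖z‖) ^ (2 * k) ≤ 1 + ∑ i, vmap z i ^ k := by
  have hnonneg (i : Fin d) : 0 ≤ vmap z i := by unfold vmap; positivity
  have hsum : 0 ≤ ∑ i, vmap z i ^ k := Finset.sum_nonneg fun i _ => pow_nonneg (hnonneg i) k
  rcases le_total ‖z‖ 1 with h | h
  · rw [max_eq_left h, one_pow]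
    linarith
  rw [max_eq_right h]
  have hz : 0 < ‖z‖ := zero_lt_one.trans_le h
  obtain ⟨s, hs⟩ : ∃ s, ‖z‖ ≤ |coord s z| := by
    by_contra! hlt
    refine lt_irrefl ‖z‖ ?_
    conv_lhs => rw [Prod.norm_def]
    exact max_lt ((pi_norm_lt_iff hz).mpr fun i => hlt (Sum.inl i))
      ((pi_norm_lt_iff hz).mpr fun i => hlt (Sum.inr i))
  have hv : ‖z‖ ^ 2 ≤ vmap z (component s) := by
    refine (pow_le_pow_left₀ hz.le hs 2).trans ?_
    rw [sq_abs]
    rcases s with i | i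
    · exact le_add_of_nonneg_right (sq_nonneg (z.2 i))
    · exact le_add_of_nonneg_left (sq_nonneg (z.1 i))
  calc ‖z‖ ^ (2 * k) = (‖z‖ ^ 2) ^ k := pow_mul _ _ _
    _ ≤ vmap z (component s) ^ k := by gcongr
    _ ≤ ∑ i, vmap z i ^ k := Finset.single_le_sum (f := fun i => vmap z i ^ k)
        (fun i _ => pow_nonneg (hnonneg i) k) (Finset.mem_univ _)
    _ ≤ 1 + ∑ i, vmap z i ^ k := by linarith

theorem pow_max_one_norm_mul_le {f : (Fin d → ℝ) → ℂ} {k : ℕ} {M : ℝ}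
    (h : ∀ m : Fin d → ℕ, ∑ i, m i ≤ k → ∀ t ∈ closure (Rpos d), (∏ i, t i ^ m i) * ‖f t‖ ≤ M)
    (z : EE d) : (max 1 ‖z‖) ^ (2 * k) * ‖f (vmap z)‖ ≤ (d + 1) * M := by
  have hv := vmap_mem_closure z
  have h₀ : ‖f (vmap z)‖ ≤ M := by simpa using h 0 (by simp) _ hv
  have h₁ (i : Fin d) : vmap z i ^ k * ‖f (vmap z)‖ ≤ M := by
    have := h (Pi.single i k) (by simp) _ hv
    rwa [Fintype.prod_eq_single i fun j hj => by simp [hj], Pi.single_eq_same] at this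
  calc (max 1 ‖z‖) ^ (2 * k) * ‖f (vmap z)‖
      ≤ (1 + ∑ i, vmap z i ^ k) * ‖f (vmap z)‖ := by
        gcongr
        exact pow_max_one_norm_le z k
    _ = ‖f (vmap z)‖ + ∑ i, vmap z i ^ k * ‖f (vmap z)‖ := by rw [add_mul, one_mul, Finset.sum_mul]
    _ ≤ M + ∑ _i : Fin d, M := add_le_add h₀ (Finset.sum_le_sum fun i _ => h₁ i)
    _ = (d + 1) * M := by simp; ring

theorem weighted_norm_le_of_mem_closure {s : Set (Fin d → ℝ)} {f : (Fin d → ℝ) → ℂ}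
    (hf : ContinuousOn f (closure s)) {m : Fin d → ℕ} {M : ℝ}
    (h : ∀ t ∈ s, (∏ i, t i ^ m i) * ‖f t‖ ≤ M) {t : Fin d → ℝ} (ht : t ∈ closure s) :
    (∏ i, t i ^ m i) * ‖f t‖ ≤ M := by
  have : (nhdsWithin t s).NeBot := mem_closure_iff_nhdsWithin_neBot.mp ht
  have hc : ContinuousWithinAt (fun t => (∏ i, t i ^ m i) * ‖f t‖) s t :=
    ContinuousWithinAt.mul
      (continuous_finsetProd _ fun i _ => (continuous_apply i).pow _).continuousWithinAt
      ((hf t ht).mono subset_closure).norm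
  exact le_of_tendsto hc (eventually_nhdsWithin_of_forall h)

theorem IsSPlus.exists_ladder {σ σb : (Fin d → ℝ) → ℂ} (hσ : IsSPlus σ)
    (hc : ContinuousOn σb {x | ∀ i, 0 ≤ x i}) (heq : ∀ x ∈ Rpos d, σb x = σ x) :
    ∃ G, IsLadder G ∧ (G 0 = fun z => σb (vmap z)) ∧ ∀ (n : Fin d → ℕ) (k : ℕ) (M : ℝ),
      (∀ m : Fin d → ℕ, ∑ i, m i ≤ k → ∀ t ∈ Rpos d, (∏ i, t i ^ m i) * ‖mderiv n σ t‖ ≤ M) →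
      ∀ z, (max 1 ‖z‖) ^ (2 * k) * ‖G n z‖ ≤ (d + 1) * M := by
  choose g hgc hg using hσ.2.1
  rw [← closure_Rpos] at hc
  simp only [← closure_Rpos] at hgc
  refine ⟨fun n z => g n (vmap z), (hσ.isJet hgc hg).isLadder, ?_, fun n k M h z => ?_⟩
  · have hs : Set.EqOn (g 0) σb (Rpos d) := fun x hx => by rw [hg 0 x hx, mderiv_zero, heq x hx]
    ext z
    exact hs.of_subset_closure (hgc 0) hc subset_closure subset_rfl (vmap_mem_closure z)
  · refine pow_max_one_norm_mul_le (fun m hm t ht => ?_) z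
    exact weighted_norm_le_of_mem_closure (hgc n)
      (fun t ht => by rw [hg n t ht]; exact h m hm t ht) ht

theorem abs_prod_pow_le {x : Fin d → ℝ} {R : ℝ} (hx : ‖x‖ ≤ R) (p : Fin d → ℕ) :
    |∏ i, x i ^ p i| ≤ R ^ ∑ i, p i := by
  rw [Finset.abs_prod, ← Finset.prod_pow_eq_pow_sum]
  refine Finset.prod_le_prod (fun i _ => abs_nonneg _) fun i _ => ?_
  rw [abs_pow]
  exact pow_le_pow_left₀ (abs_nonneg _) ((norm_le_pi_norm x i).trans hx) _

end Coordinates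

/-- For `σ ∈ S(ℝ^d₊)` with continuous extension `σb` to `[0,∞)^d`, the function
`σ̃ = σb ∘ v` is smooth, belongs to `𝒮(ℝ^{2d})`, and for every `j` there is `C > 0`
independent of `σ` bounding the `j`-th Schwartz seminorm of `σ̃` by the `2j`-th
seminorm of `σ`. -/
theorem stmt17 (d : ℕ) :
    (∀ (σ σb : (Fin d → ℝ) → ℂ), IsSPlus σ →
      ContinuousOn σb {x | ∀ i, 0 ≤ x i} → (∀ x ∈ Rpos d, σb x = σ x) →
      ContDiff ℝ (⊤ : ℕ∞) (fun z : EE d => σb (vmap z)) ∧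
      ∃ φ : SchwartzMap (EE d) ℂ, ∀ z : EE d, φ z = σb (vmap z)) ∧
    (∀ j : ℕ, ∃ C > (0:ℝ), ∀ (σ σb : (Fin d → ℝ) → ℂ), IsSPlus σ →
      ContinuousOn σb {x | ∀ i, 0 ≤ x i} → (∀ x ∈ Rpos d, σb x = σ x) →
      ∀ M : ℝ,
        (∀ n m : Fin d → ℕ, (∑ i, n i) ≤ 2*j → (∑ i, m i) ≤ 2*j →
          ∀ t ∈ Rpos d, (∏ i, t i ^ m i) * ‖mderiv n σ t‖ ≤ M) →
        ∀ p'' q'' p q : Fin d → ℕ,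
          (∑ i, p'' i) ≤ j → (∑ i, q'' i) ≤ j → (∑ i, p i) ≤ j → (∑ i, q i) ≤ j →
          ∀ z : EE d,
            |(∏ i, z.1 i ^ p'' i) * (∏ i, z.2 i ^ q'' i)| *
              ‖mderiv2 p q (fun y : EE d => σb (vmap y)) z‖ ≤ C * M) := by
  refine ⟨fun σ σb hσ hc heq => ?_, fun j => ?_⟩
  · obtain ⟨G, hG, hG₀, hbound⟩ := hσ.exists_ladder hc heq
    have hsm := hG.1 0
    have hdecay (n : Fin d → ℕ) (k : ℕ) :
        ∃ N : ℝ, ∀ z, (max 1 ‖z‖) ^ (2 * k) * ‖G n z‖ ≤ N := by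
      choose C hC using fun m => hσ.2.2 m n
      refine ⟨_, hbound n k (∑ m ∈ Fintype.piFinset fun _ => Finset.range (k + 1), |C m|)
        fun m hm t ht => (hC m t ht).trans ((le_abs_self _).trans ?_)⟩
      refine Finset.single_le_sum (f := fun m => |C m|) (fun m _ => abs_nonneg _)
        (Fintype.mem_piFinset.mpr fun i => ?_)
      have : m i ≤ ∑ i, m i := Finset.single_le_sum (fun _ _ => Nat.zero_le _) (Finset.mem_univ i)
      exact Finset.mem_range.mpr (by lia)
    have hS := (LadderExpr.base (a := 0) (b := 0) (0 : Fin d → ℕ)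
      (by simp)).exists_iteratedFDeriv_decay hG hdecay
    rw [hG₀] at hsm hS
    exact ⟨hsm, ⟨_, hsm, hS⟩, fun _ => rfl⟩
  · choose Φ hΦ hd using (LadderExpr.base (a := 0) (b := 0) (0 : Fin d → ℕ)
      (by simp)).exists_mderiv2
    choose C hC₀ hC using fun p q => (hΦ p q).exists_pow_mul_norm_le
    let I : Finset (Fin d → ℕ) := Fintype.piFinset fun _ => Finset.range (j + 1)
    have hI (p : Fin d → ℕ) (hp : ∑ i, p i ≤ j) : p ∈ I := Fintype.mem_piFinset.mpr fun i => by
      have : p i ≤ ∑ i, p i := Finset.single_le_sum (fun _ _ => Nat.zero_le _) (Finset.mem_univ i)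
      exact Finset.mem_range.mpr (by lia)
    have hS : 0 ≤ ∑ p ∈ I, ∑ q ∈ I, C p q :=
      Finset.sum_nonneg fun p _ => Finset.sum_nonneg fun q _ => hC₀ p q
    refine ⟨(1 + ∑ p ∈ I, ∑ q ∈ I, C p q) * (d + 1), by positivity,
      fun σ σb hσ hc heq M hM p'' q'' p q hp'' hq'' hp hq z => ?_⟩
    obtain ⟨G, hG, hG₀, hbound⟩ := hσ.exists_ladder hc heq
    have hM₀ : 0 ≤ M := by
      refine le_trans ?_ (hM 0 0 (by simp) (by simp) 1 fun i => one_pos)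
      simp
    have hCS : C p q ≤ 1 + ∑ p ∈ I, ∑ q ∈ I, C p q := by
      have h₁ := Finset.single_le_sum (f := C p) (fun q _ => hC₀ p q) (hI q hq)
      have h₂ := Finset.single_le_sum (f := fun p => ∑ q ∈ I, C p q)
        (fun p _ => Finset.sum_nonneg fun q _ => hC₀ p q) (hI p hp)
      linarith
    have hR : 1 ≤ max 1 ‖z‖ := le_max_left _ _
    have hweight : |(∏ i, z.1 i ^ p'' i) * (∏ i, z.2 i ^ q'' i)| ≤ (max 1 ‖z‖) ^ (2 * j) := by
      rw [abs_mul]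
      calc _ ≤ (max 1 ‖z‖) ^ (∑ i, p'' i) * (max 1 ‖z‖) ^ (∑ i, q'' i) :=
            mul_le_mul (abs_prod_pow_le ((norm_fst_le z).trans (le_max_right _ _)) _)
              (abs_prod_pow_le ((norm_snd_le z).trans (le_max_right _ _)) _)
              (abs_nonneg _) (by positivity)
        _ ≤ (max 1 ‖z‖) ^ (2 * j) := by
            rw [← pow_add]
            exact pow_le_pow_right₀ hR (by lia)
    rw [← hG₀, hd p q G hG]
    calc _ ≤ (max 1 ‖z‖) ^ (2 * j) * ‖Φ p q G z‖ := by gcongr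
      _ ≤ C p q * ((d + 1) * M) := by
          refine hC p q G z _ (2 * j) (2 * j) (by lia) fun n hn => ?_
          exact hbound n (2 * j) M (fun m hm t ht => hM n m (by lia) hm t ht) z
      _ ≤ (1 + ∑ p ∈ I, ∑ q ∈ I, C p q) * ((d + 1) * M) := by gcongr
      _ = _ := by ring
end
end
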